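/- Fix real numbers α, β and define F(z) = 1 - z·e^α·e^{βz} and G(z) = -z + α + β·e^{-z}, both entire functions on ℂ. Then the map λ ↦ e^{-λ} is a bijection from the zero set {λ ∈ ℂ : G(λ) = 0} onto the nonzero zero set {μ ∈ ℂ \ {0} : F(μ) = 0}. -/

import Mathlib

open Complex

/-- For fixed real `α, β`, with `F(z) = 1 - z e^α e^{βz}` and
`G(z) = -z + α + β e^{-z}`, the map `λ ↦ e^{-λ}` is a bijection from the zero
set of `G` onto the nonzero zero set of `F`. -/
theorem stmt8 (α β : ℝ) :
    Set.BijOn (fun z : ℂ => Complex.exp (-z))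
      {z : ℂ | -z + (α : ℂ) + (β : ℂ) * Complex.exp (-z) = 0}
      {z : ℂ | z ≠ 0 ∧ 1 - z * Complex.exp (α : ℂ) * Complex.exp ((β : ℂ) * z) = 0} := by
  refine ⟨?_, ?_, ?_⟩
  · intro z hz
    simp only [Set.mem_ofPred_eq] at hz ⊢
    refine ⟨Complex.exp_ne_zero _, ?_⟩
    rw [← Complex.exp_add, ← Complex.exp_add, hz, Complex.exp_zero, sub_self]
  · intro z hz w hw h
    simp only [Set.mem_ofPred_eq] at hz hw h
    rw [h] at hz
    linear_combination hw - hz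
  · rintro m ⟨_, hm⟩
    have key : Complex.exp (-((α : ℂ) + β * m)) = m := by
      rw [Complex.exp_neg, Complex.exp_add]
      refine inv_eq_of_mul_eq_one_right ?_
      linear_combination -hm
    refine ⟨(α : ℂ) + β * m, ?_, key⟩
    simp only [Set.mem_ofPred_eq]
    rw [key]
    ring
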